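/- The subgroup of GL₂(ℂ) generated by the eight explicit matrices u₁, …, u₈ equals O¹ = {U ∈ O : det U = 1}. That is, every matrix in O with determinant 1 is a finite product of the matrices u₁,…,u₈ and their inverses, and conversely every such product lies in O¹. -/

import Mathlib

open Complex Matrix

/-- The golden ratio `θ = (1+√5)/2`. -/
noncomputable def gr : ℝ := (1 + Real.sqrt 5) / 2

/-- A generic element `a + b·i + c·θ + d·i·θ` of `R = ℤ[i,θ] ⊂ ℂ`. -/
noncomputable def gold (a b c d : ℤ) : ℂ := a + b * I + c * (gr : ℂ) + d * I * (gr : ℂ)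

/-- Its conjugate `σ(a + b·i + c·θ + d·i·θ) = a + b·i + c·θ̄ + d·i·θ̄` with `θ̄ = 1 - θ`. -/
noncomputable def goldBar (a b c d : ℤ) : ℂ :=
  a + b * I + c * (1 - (gr : ℂ)) + d * I * (1 - (gr : ℂ))

/-- The matrix `[[x₁, x₂],[i·σ(x₂), σ(x₁)]]` with `x₁ = a+bi+cθ+diθ`, `x₂ = e+fi+gθ+hiθ`. -/
noncomputable def Omat (a b c d e f g h : ℤ) : Matrix (Fin 2) (Fin 2) ℂ :=
  !![gold a b c d, gold e f g h; I * goldBar e f g h, goldBar a b c d]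

/-- The maximal order `O` of the Golden Code algebra. -/
def Oset : Set (Matrix (Fin 2) (Fin 2) ℂ) :=
  { M | ∃ a b c d e f g h : ℤ, M = Omat a b c d e f g h }


/-- `O¹`, the set of elements of `O` of determinant (reduced norm) one. -/
def O1 : Set (Matrix (Fin 2) (Fin 2) ℂ) := { M | M ∈ Oset ∧ M.det = 1 }


noncomputable def u₁ : Matrix (Fin 2) (Fin 2) ℂ :=
  !![I * (gr : ℂ), 0; 0, I * (1 - (gr : ℂ))]
noncomputable def u₂ : Matrix (Fin 2) (Fin 2) ℂ :=
  !![I, 1 + I; I - 1, I]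
noncomputable def u₃ : Matrix (Fin 2) (Fin 2) ℂ :=
  !![(gr : ℂ), 1 + I; I - 1, 1 - (gr : ℂ)]
noncomputable def u₄ : Matrix (Fin 2) (Fin 2) ℂ :=
  !![(gr : ℂ), -1 - I; 1 - I, 1 - (gr : ℂ)]
noncomputable def u₅ : Matrix (Fin 2) (Fin 2) ℂ :=
  !![1 + I, 1 + I * (1 - (gr : ℂ)); I * (1 + I * (gr : ℂ)), 1 + I]
noncomputable def u₆ : Matrix (Fin 2) (Fin 2) ℂ :=
  !![1 + I, 1 + I * (gr : ℂ); I * (1 + I * (1 - (gr : ℂ))), 1 + I]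
noncomputable def u₇ : Matrix (Fin 2) (Fin 2) ℂ :=
  !![1 - I, (1 - (gr : ℂ)) + I; I * ((gr : ℂ) + I), 1 - I]
noncomputable def u₈ : Matrix (Fin 2) (Fin 2) ℂ :=
  !![1 - I, (gr : ℂ) + I; I * ((1 - (gr : ℂ)) + I), 1 - I]



theorem gr_sq : (gr : ℂ) * gr = gr + 1 := by
  have h : gr * gr = gr + 1 := by
    have h5 : Real.sqrt 5 * Real.sqrt 5 = 5 := Real.mul_self_sqrt (by norm_num)
    unfold gr; nlinarith
  exact_mod_cast h

theorem goldBar_eq (a b c d : ℤ) : goldBar a b c d = gold (a + c) (b + d) (-c) (-d) := by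
  simp only [gold, goldBar]; push_cast; ring

theorem I_mul_gold (a b c d : ℤ) : I * gold a b c d = gold (-b) a (-d) c := by
  simp only [gold]; push_cast
  linear_combination (b + d * (gr : ℂ)) * I_mul_I

theorem gold_add (a b c d a' b' c' d' : ℤ) :
    gold a b c d + gold a' b' c' d' = gold (a + a') (b + b') (c + c') (d + d') := by
  simp only [gold]; push_cast; ring

theorem gold_mul (a b c d e f g h : ℤ) :
    gold a b c d * gold e f g h =
      gold (a*e-b*f+c*g-d*h) (a*f+b*e+c*h+d*g) (a*g-b*h+c*e-d*f+c*g-d*h)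
        (a*h+b*g+c*f+d*e+c*h+d*g) := by
  simp only [gold]; push_cast
  linear_combination ((c + d * I) * (g + h * I)) * gr_sq +
    (b * f + (b * h + d * f) * (gr : ℂ) + d * h * (gr + 1)) * I_mul_I

theorem gold_one : gold 1 0 0 0 = 1 := by simp [gold]

theorem gold_re_im (a b c d : ℤ) :
    gold a b c d = ((a + c * gr : ℝ) : ℂ) + ((b + d * gr : ℝ) : ℂ) * I := by
  simp only [gold]; push_cast; ring

theorem det_Omat (a b c d e f g h : ℤ) : (Omat a b c d e f g h).det =
    gold (a*a-b*b+a*c-b*d-c*c+d*d + (2*e*f+e*h+f*g-2*g*h))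
      (2*a*b+a*d+b*c-2*c*d - (e*e-f*f+e*g-f*h-g*g+h*h)) 0 0 := by
  rw [Omat, Matrix.det_fin_two_of, sub_eq_add_neg]
  have hn : ∀ x y z w : ℤ, - gold x y z w = gold (-x) (-y) (-z) (-w) := by
    intro x y z w; simp only [gold]; push_cast; ring
  simp only [goldBar_eq, I_mul_gold, gold_mul, hn, gold_add]
  congr 1 <;> ring

theorem gold_eq_one (x y : ℤ) : gold x y 0 0 = 1 ↔ x = 1 ∧ y = 0 := by
  constructor
  · intro h
    have h1 := congrArg Complex.re h
    have h2 := congrArg Complex.im h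
    simp [gold] at h1 h2
    exact ⟨by exact_mod_cast h1, by exact_mod_cast h2⟩
  · rintro ⟨rfl, rfl⟩; exact gold_one

theorem Omat_mul (a b c d e f g h a' b' c' d' e' f' g' h' : ℤ) :
    Omat a b c d e f g h * Omat a' b' c' d' e' f' g' h' =
      Omat (a*a'-b*b'+c*c'-d*d'-e*f'-e*h'-e'*f-f*g'+g*h'+g'*h)
        (a*b'+a'*b+c*d'+c'*d+e*e'+e*g'-f*f'-f*h'-g*g'+h*h')
        (a*c'-b*d'+a'*c-b'*d+c*c'-d*d'+e*h'+f*g'-f'*g-e'*h)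
        (a*d'+b*c'+b'*c+a'*d+c*d'+c'*d-e*g'+f*h'+e'*g-f'*h)
        (a*e'-b*f'+c*g'-d*h'+a'*e+c'*e-b'*f-d'*f-c'*g+d'*h)
        (a*f'+b*e'+c*h'+d*g'+b'*e+d'*e+a'*f+c'*f-d'*g-c'*h)
        (a*g'-b*h'+c*e'-d*f'+c*g'-d*h'-c'*e+d'*f+a'*g-b'*h)
        (a*h'+b*g'+c*f'+d*e'+c*h'+d*g'-d'*e-c'*f+b'*g+a'*h) := by
  rw [Omat, Omat, Omat, Matrix.mul_fin_two]
  simp only [goldBar_eq, I_mul_gold, gold_mul, gold_add]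
  congr 1
  ext i j
  fin_cases i <;> fin_cases j <;> simp <;> congr 1 <;> ring

theorem Omat_one : Omat 1 0 0 0 0 0 0 0 = 1 := by
  rw [Omat, Matrix.one_fin_two]; simp [gold, goldBar]

/-- squared Frobenius norm -/
def nm (a b c d e f g h : ℤ) : ℤ :=
  (2*a*a+2*a*c+3*c*c) + (2*b*b+2*b*d+3*d*d) + (2*e*e+2*e*g+3*g*g) + (2*f*f+2*f*h+3*h*h)

/-- The sixteen generators. -/
def gens : Set (Matrix (Fin 2) (Fin 2) ℂ) :=
  {u₁, u₂, u₃, u₄, u₅, u₆, u₇, u₈, u₁⁻¹, u₂⁻¹, u₃⁻¹, u₄⁻¹, u₅⁻¹, u₆⁻¹, u₇⁻¹, u₈⁻¹}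

theorem inv_aux (M N : Matrix (Fin 2) (Fin 2) ℂ) (h : M * N = 1) : M⁻¹ = N :=
  Matrix.inv_eq_right_inv h


theorem u₁_eq : u₁ = Omat 0 0 0 1 0 0 0 0 := by
  simp only [u₁, Omat, gold, goldBar]
  congr 1; ext i j
  fin_cases i <;> fin_cases j <;> simp <;>
    first | done | ring1 | linear_combination I_mul_I | linear_combination -I_mul_I

theorem u₁_inv : u₁⁻¹ = Omat 0 1 0 (-1) 0 0 0 0 := by
  apply inv_aux
  rw [u₁_eq, Omat_mul, ← Omat_one]; congr 1

theorem u₂_eq : u₂ = Omat 0 1 0 0 1 1 0 0 := by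
  simp only [u₂, Omat, gold, goldBar]
  congr 1; ext i j
  fin_cases i <;> fin_cases j <;> simp <;>
    first | done | ring1 | linear_combination I_mul_I | linear_combination -I_mul_I

theorem u₂_inv : u₂⁻¹ = Omat 0 1 0 0 (-1) (-1) 0 0 := by
  apply inv_aux
  rw [u₂_eq, Omat_mul, ← Omat_one]; congr 1

theorem u₃_eq : u₃ = Omat 0 0 1 0 1 1 0 0 := by
  simp only [u₃, Omat, gold, goldBar]
  congr 1; ext i j
  fin_cases i <;> fin_cases j <;> simp <;>
    first | done | ring1 | linear_combination I_mul_I | linear_combination -I_mul_I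

theorem u₃_inv : u₃⁻¹ = Omat 1 0 (-1) 0 (-1) (-1) 0 0 := by
  apply inv_aux
  rw [u₃_eq, Omat_mul, ← Omat_one]; congr 1

theorem u₄_eq : u₄ = Omat 0 0 1 0 (-1) (-1) 0 0 := by
  simp only [u₄, Omat, gold, goldBar]
  congr 1; ext i j
  fin_cases i <;> fin_cases j <;> simp <;>
    first | done | ring1 | linear_combination I_mul_I | linear_combination -I_mul_I

theorem u₄_inv : u₄⁻¹ = Omat 1 0 (-1) 0 1 1 0 0 := by
  apply inv_aux
  rw [u₄_eq, Omat_mul, ← Omat_one]; congr 1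

theorem u₅_eq : u₅ = Omat 1 1 0 0 1 1 0 (-1) := by
  simp only [u₅, Omat, gold, goldBar]
  congr 1; ext i j
  fin_cases i <;> fin_cases j <;> simp <;>
    first | done | ring1 | linear_combination I_mul_I | linear_combination -I_mul_I

theorem u₅_inv : u₅⁻¹ = Omat 1 1 0 0 (-1) (-1) 0 1 := by
  apply inv_aux
  rw [u₅_eq, Omat_mul, ← Omat_one]; congr 1

theorem u₆_eq : u₆ = Omat 1 1 0 0 1 0 0 1 := by
  simp only [u₆, Omat, gold, goldBar]
  congr 1; ext i j
  fin_cases i <;> fin_cases j <;> simp <;>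
    first | done | ring1 | linear_combination I_mul_I | linear_combination -I_mul_I

theorem u₆_inv : u₆⁻¹ = Omat 1 1 0 0 (-1) 0 0 (-1) := by
  apply inv_aux
  rw [u₆_eq, Omat_mul, ← Omat_one]; congr 1

theorem u₇_eq : u₇ = Omat 1 (-1) 0 0 1 1 (-1) 0 := by
  simp only [u₇, Omat, gold, goldBar]
  congr 1; ext i j
  fin_cases i <;> fin_cases j <;> simp <;>
    first | done | ring1 | linear_combination I_mul_I | linear_combination -I_mul_I

theorem u₇_inv : u₇⁻¹ = Omat 1 (-1) 0 0 (-1) (-1) 1 0 := by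
  apply inv_aux
  rw [u₇_eq, Omat_mul, ← Omat_one]; congr 1

theorem u₈_eq : u₈ = Omat 1 (-1) 0 0 0 1 1 0 := by
  simp only [u₈, Omat, gold, goldBar]
  congr 1; ext i j
  fin_cases i <;> fin_cases j <;> simp <;>
    first | done | ring1 | linear_combination I_mul_I | linear_combination -I_mul_I

theorem u₈_inv : u₈⁻¹ = Omat 1 (-1) 0 0 0 (-1) (-1) 0 := by
  apply inv_aux
  rw [u₈_eq, Omat_mul, ← Omat_one]; congr 1

def pm (a b c d e f g h : ℤ) : ℤ := a*a+b*b+c*c+d*d+e*e+f*f+g*g+h*h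
def pn (a b c d e f g h : ℤ) : ℤ := 2*a*c+2*b*d+c*c+d*d+2*e*g+2*f*h+g*g+h*h
def ps (a b c d e f g h : ℤ) : ℤ := -a*f-a*h+b*e+b*g+c*h-d*g+a*e+c*e+b*f+d*f-c*g-d*h
def pt (a b c d e f g h : ℤ) : ℤ := a*h-b*g-c*f+d*e-c*e-d*f+a*g+b*h

theorem nm_eq (a b c d e f g h : ℤ) : nm a b c d e f g h = 2 * pm a b c d e f g h + pn a b c d e f g h := by
  simp only [nm, pm, pn]; ring

theorem form_eq (a b c d e f g h : ℤ) :
    pm a b c d e f g h ^ 2 + pm a b c d e f g h * pn a b c d e f g h - pn a b c d e f g h ^ 2 - 2 * ps a b c d e f g h ^ 2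
      - 2 * ps a b c d e f g h * pt a b c d e f g h - 3 * pt a b c d e f g h ^ 2 =
    (a*a-b*b+a*c-b*d-c*c+d*d + (2*e*f+e*h+f*g-2*g*h)) ^ 2 +
      (2*a*b+a*d+b*c-2*c*d - (e*e-f*f+e*g-f*h-g*g+h*h)) ^ 2 := by
  simp only [pm, pn, ps, pt]; ring

theorem key_ineq (T N Y Z : ℤ) (p1 : 0 ≤ N) (p2 : 0 ≤ Y) (p3 : 0 ≤ Z) (hT : 0 ≤ T)
    (e1 : 5 * N ≤ T) (e2 : 2 * Y ≤ T) (e3 : N + 4 * Z ≤ T)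
    (e4 : 5 * N + 8 * Y + 20 * Z ≤ 7 * T) :
    5 * (5 * N ^ 2 + 2 * Y ^ 2 + 10 * Z ^ 2) ≤ 4 * T ^ 2 := by
  have q1 := mul_nonneg p1 (sub_nonneg.2 e1)
  rcases le_total (4 * Y) T with h | h
  · have a1 : (4 * Y) * (4 * Y) ≤ T * T := mul_self_le_mul_self (by omega) h
    have a2 : (4 * Z) * (4 * Z) ≤ (T - N) * (T - N) := mul_self_le_mul_self (by omega) (by omega)
    linarith [mul_nonneg p1 hT, mul_nonneg hT hT]
  · have a2 : (20 * Z) * (20 * Z) ≤ (7 * T - 5 * N - 8 * Y) * (7 * T - 5 * N - 8 * Y) :=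
      mul_self_le_mul_self (by omega) (by omega)
    have h' := sub_nonneg.2 h
    have e2' := sub_nonneg.2 e2
    have e1' := sub_nonneg.2 e1
    nlinarith only [a2, q1, mul_nonneg h' e2', mul_nonneg p1 h', mul_nonneg p1 e2',
      mul_nonneg e1' h', mul_nonneg e1' e2', mul_nonneg hT h', mul_nonneg hT e2',
      mul_nonneg hT e1', mul_nonneg hT p1, mul_nonneg hT hT]

/-- If no generator decreases the norm, the norm is 2 or 4. -/
theorem dirichlet (m n s t : ℤ) (hT : 0 < 2 * m + n)
    (hq : m ^ 2 + m * n - n ^ 2 - 2 * s ^ 2 - 2 * s * t - 3 * t ^ 2 = 1)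
    (h0 : 0 ≤ (1) * m + (3) * n + (0) * s + (0) * t)
    (h1 : 0 ≤ (1) * m + (-2) * n + (0) * s + (0) * t)
    (h2 : 0 ≤ (4) * m + (2) * n + (8) * s + (4) * t)
    (h3 : 0 ≤ (4) * m + (2) * n + (-8) * s + (-4) * t)
    (h4 : 0 ≤ (5) * m + (5) * n + (0) * s + (10) * t)
    (h5 : 0 ≤ (5) * m + (0) * n + (0) * s + (10) * t)
    (h6 : 0 ≤ (5) * m + (5) * n + (0) * s + (-10) * t)
    (h7 : 0 ≤ (5) * m + (0) * n + (0) * s + (-10) * t)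
    (h8 : 0 ≤ (7) * m + (6) * n + (8) * s + (-6) * t)
    (h9 : 0 ≤ (7) * m + (6) * n + (-8) * s + (6) * t)
    (h10 : 0 ≤ (7) * m + (1) * n + (8) * s + (14) * t)
    (h11 : 0 ≤ (7) * m + (1) * n + (-8) * s + (-14) * t)
    (h12 : 0 ≤ (7) * m + (6) * n + (-8) * s + (-14) * t)
    (h13 : 0 ≤ (7) * m + (6) * n + (8) * s + (14) * t)
    (h14 : 0 ≤ (7) * m + (1) * n + (-8) * s + (6) * t)
    (h15 : 0 ≤ (7) * m + (1) * n + (8) * s + (-6) * t) :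
    2 * m + n = 2 ∨ 2 * m + n = 4 := by
  obtain ⟨T, hTd⟩ : ∃ T, T = 2 * m + n := ⟨_, rfl⟩
  obtain ⟨y, hy⟩ : ∃ y, y = 2 * s + t := ⟨_, rfl⟩
  rw [← hTd] at hT ⊢
  have hq' : T ^ 2 = 4 + 5 * n ^ 2 + 2 * y ^ 2 * 1 + 10 * t ^ 2 := by
    subst hTd hy; linarith [hq, mul_comm m n]
  have e1 : 5 * |n| ≤ T := by
    rcases abs_cases n with h | h <;> omega
  have e2 : 2 * |y| ≤ T := by
    rcases abs_cases y with h | h <;> omega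
  have e3 : |n| + 4 * |t| ≤ T := by
    rcases abs_cases n with h | h <;> rcases abs_cases t with h' | h' <;> omega
  have e4 : 5 * |n| + 8 * |y| + 20 * |t| ≤ 7 * T := by
    rcases abs_cases n with h | h <;> rcases abs_cases t with h' | h' <;>
      rcases abs_cases y with h'' | h'' <;> omega
  rw [← sq_abs n, ← sq_abs y, ← sq_abs t] at hq'
  have p1 := abs_nonneg n
  have p2 := abs_nonneg y
  have p3 := abs_nonneg t
  generalize |n| = N at *
  generalize |y| = Y at *
  generalize |t| = Z at *
  have key : 5 * (5 * N ^ 2 + 2 * Y ^ 2 + 10 * Z ^ 2) ≤ 4 * T ^ 2 := by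
    exact key_ineq T N Y Z p1 p2 p3 hT.le e1 e2 e3 e4
  have hT4 : T ≤ 4 := by nlinarith
  have hN : N = 0 := by omega
  have hY : Y ≤ 2 := by omega
  have hZ : Z ≤ 1 := by omega
  subst hN
  interval_cases T <;> interval_cases Y <;> interval_cases Z <;> omega

theorem pair_small (a c : ℤ) :
    0 ≤ 2*a*a+2*a*c+3*c*c ∧ (2*a*a+2*a*c+3*c*c ≤ 4 →
      (c = 0 ∧ (a = 0 ∨ a = 1 ∨ a = -1)) ∨ 2*a*a+2*a*c+3*c*c = 3) := by
  refine ⟨by nlinarith [sq_nonneg (a + c), sq_nonneg a, sq_nonneg c], fun h => ?_⟩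
  have h1 : c ≤ 1 := by nlinarith [sq_nonneg (2 * a + c)]
  have h2 : -1 ≤ c := by nlinarith [sq_nonneg (2 * a + c)]
  have h3 : a ≤ 1 := by nlinarith [sq_nonneg (a + 3 * c)]
  have h4 : -1 ≤ a := by nlinarith [sq_nonneg (a + 3 * c)]
  interval_cases c <;> interval_cases a <;> simp_all

set_option maxHeartbeats 1000000 in
theorem small (a b c d e f g h : ℤ) (hn : nm a b c d e f g h = 2 ∨ nm a b c d e f g h = 4)
    (h1 : a*a-b*b+a*c-b*d-c*c+d*d + (2*e*f+e*h+f*g-2*g*h) = 1)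
    (h2 : 2*a*b+a*d+b*c-2*c*d - (e*e-f*f+e*g-f*h-g*g+h*h) = 0) :
    (a = 1 ∨ a = -1) ∧ b = 0 ∧ c = 0 ∧ d = 0 ∧ e = 0 ∧ f = 0 ∧ g = 0 ∧ h = 0 := by
  have key : ∀ x y : ℤ, 2*x*x+2*x*y+3*y*y ≠ 1 := by
    intro x y hxy
    obtain ⟨_, hh⟩ := pair_small x y
    rcases hh (by omega) with ⟨rfl, rfl | rfl | rfl⟩ | hh <;> omega
  have kA := key a c
  have kB := key b d
  have kE := key e g
  have kF := key f h
  have pA := (pair_small a c).1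
  have pB := (pair_small b d).1
  have pE := (pair_small e g).1
  have pF := (pair_small f h).1
  unfold nm at hn
  have lin : ∀ A B E F : ℤ, 0 ≤ A → 0 ≤ B → 0 ≤ E → 0 ≤ F → A ≠ 1 → B ≠ 1 → E ≠ 1 → F ≠ 1 →
      (A + B + E + F = 2 ∨ A + B + E + F = 4) →
      (A ≤ 4 ∧ A ≠ 3) ∧ (B ≤ 4 ∧ B ≠ 3) ∧ (E ≤ 4 ∧ E ≠ 3) ∧ (F ≤ 4 ∧ F ≠ 3) := by
    intro A B E F _ _ _ _ _ _ _ _ h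
    refine ⟨⟨?_, ?_⟩, ⟨?_, ?_⟩, ⟨?_, ?_⟩, ⟨?_, ?_⟩⟩ <;> omega
  obtain ⟨lA, lB, lE, lF⟩ := lin _ _ _ _ pA pB pE pF kA kB kE kF hn
  obtain ⟨rfl, rA⟩ := ((pair_small a c).2 lA.1).resolve_right lA.2
  obtain ⟨rfl, rB⟩ := ((pair_small b d).2 lB.1).resolve_right lB.2
  obtain ⟨rfl, rE⟩ := ((pair_small e g).2 lE.1).resolve_right lE.2
  obtain ⟨rfl, rF⟩ := ((pair_small f h).2 lF.1).resolve_right lF.2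
  clear lin key lA lB lE lF
  clear kA kB kE kF pA pB pE pF
  rcases rA with rfl | rfl | rfl <;> rcases rB with rfl | rfl | rfl <;>
    rcases rE with rfl | rfl | rfl <;> rcases rF with rfl | rfl | rfl <;>
    first | (exfalso; revert h1 h2 hn; norm_num; done) | norm_num

theorem mem_gens {M : Matrix (Fin 2) (Fin 2) ℂ} (h : M ∈ gens) : M ∈ Submonoid.closure gens :=
  Submonoid.subset_closure h

theorem step0 (a b c d e f g h : ℤ) :
    ∃ a' b' c' d' e' f' g' h' : ℤ, Omat a b c d e f g h = u₁⁻¹ * Omat a' b' c' d' e' f' g' h' ∧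
      nm a' b' c' d' e' f' g' h' = nm a b c d e f g h + ((1) * pm a b c d e f g h + (3) * pn a b c d e f g h + (0) * ps a b c d e f g h + (0) * pt a b c d e f g h) := by
  refine ⟨-d, c, -b-d, a+c, -h, g, -f-h, e+g, ?_, ?_⟩
  · rw [u₁_inv, Omat_mul]; congr 1 <;> ring
  · simp only [nm, pm, pn, ps, pt]; ring

theorem step1 (a b c d e f g h : ℤ) :
    ∃ a' b' c' d' e' f' g' h' : ℤ, Omat a b c d e f g h = u₁ * Omat a' b' c' d' e' f' g' h' ∧
      nm a' b' c' d' e' f' g' h' = nm a b c d e f g h + ((1) * pm a b c d e f g h + (-2) * pn a b c d e f g h + (0) * ps a b c d e f g h + (0) * pt a b c d e f g h) := by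
  refine ⟨-b+d, a-c, b, -a, -f+h, e-g, f, -e, ?_, ?_⟩
  · rw [u₁_eq, Omat_mul]; congr 1 <;> ring
  · simp only [nm, pm, pn, ps, pt]; ring

theorem step2 (a b c d e f g h : ℤ) :
    ∃ a' b' c' d' e' f' g' h' : ℤ, Omat a b c d e f g h = u₂⁻¹ * Omat a' b' c' d' e' f' g' h' ∧
      nm a' b' c' d' e' f' g' h' = nm a b c d e f g h + ((4) * pm a b c d e f g h + (2) * pn a b c d e f g h + (8) * ps a b c d e f g h + (4) * pt a b c d e f g h) := by
  refine ⟨-b-f-h-e-g, a+e+g-f-h, -d+h+g, c-g+h, -f+a+c-b-d, e+b+d+a+c, -h-c+d, g-d-c, ?_, ?_⟩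
  · rw [u₂_inv, Omat_mul]; congr 1 <;> ring
  · simp only [nm, pm, pn, ps, pt]; ring

theorem step3 (a b c d e f g h : ℤ) :
    ∃ a' b' c' d' e' f' g' h' : ℤ, Omat a b c d e f g h = u₂ * Omat a' b' c' d' e' f' g' h' ∧
      nm a' b' c' d' e' f' g' h' = nm a b c d e f g h + ((4) * pm a b c d e f g h + (2) * pn a b c d e f g h + (-8) * ps a b c d e f g h + (-4) * pt a b c d e f g h) := by
  refine ⟨-b+f+h+e+g, a-e-g+f+h, -d-h-g, c+g-h, -f-a-c+b+d, e-b-d-a-c, -h+c-d, g+d+c, ?_, ?_⟩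
  · rw [u₂_eq, Omat_mul]; congr 1 <;> ring
  · simp only [nm, pm, pn, ps, pt]; ring

theorem step4 (a b c d e f g h : ℤ) :
    ∃ a' b' c' d' e' f' g' h' : ℤ, Omat a b c d e f g h = u₃⁻¹ * Omat a' b' c' d' e' f' g' h' ∧
      nm a' b' c' d' e' f' g' h' = nm a b c d e f g h + ((5) * pm a b c d e f g h + (5) * pn a b c d e f g h + (0) * ps a b c d e f g h + (10) * pt a b c d e f g h) := by
  refine ⟨c-f-h-e-g, d+e+g-f-h, a+c+h+g, b+d-g+h, g+a+c-b-d, h+b+d+a+c, e+g-c+d, f+h-d-c, ?_, ?_⟩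
  · rw [u₃_inv, Omat_mul]; congr 1 <;> ring
  · simp only [nm, pm, pn, ps, pt]; ring

theorem step5 (a b c d e f g h : ℤ) :
    ∃ a' b' c' d' e' f' g' h' : ℤ, Omat a b c d e f g h = u₃ * Omat a' b' c' d' e' f' g' h' ∧
      nm a' b' c' d' e' f' g' h' = nm a b c d e f g h + ((5) * pm a b c d e f g h + (0) * pn a b c d e f g h + (0) * ps a b c d e f g h + (10) * pt a b c d e f g h) := by
  refine ⟨a-c+f+h+e+g, b-d-e-g+f+h, -a-h-g, -b+g-h, e-g-a-c+b+d, f-h-b-d-a-c, -e+c-d, -f+d+c, ?_, ?_⟩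
  · rw [u₃_eq, Omat_mul]; congr 1 <;> ring
  · simp only [nm, pm, pn, ps, pt]; ring

theorem step6 (a b c d e f g h : ℤ) :
    ∃ a' b' c' d' e' f' g' h' : ℤ, Omat a b c d e f g h = u₄⁻¹ * Omat a' b' c' d' e' f' g' h' ∧
      nm a' b' c' d' e' f' g' h' = nm a b c d e f g h + ((5) * pm a b c d e f g h + (5) * pn a b c d e f g h + (0) * ps a b c d e f g h + (-10) * pt a b c d e f g h) := by
  refine ⟨c+f+h+e+g, d-e-g+f+h, a+c-h-g, b+d+g-h, g-a-c+b+d, h-b-d-a-c, e+g+c-d, f+h+d+c, ?_, ?_⟩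
  · rw [u₄_inv, Omat_mul]; congr 1 <;> ring
  · simp only [nm, pm, pn, ps, pt]; ring

theorem step7 (a b c d e f g h : ℤ) :
    ∃ a' b' c' d' e' f' g' h' : ℤ, Omat a b c d e f g h = u₄ * Omat a' b' c' d' e' f' g' h' ∧
      nm a' b' c' d' e' f' g' h' = nm a b c d e f g h + ((5) * pm a b c d e f g h + (0) * pn a b c d e f g h + (0) * ps a b c d e f g h + (-10) * pt a b c d e f g h) := by
  refine ⟨a-c-f-h-e-g, b-d+e+g-f-h, -a+h+g, -b-g+h, e-g+a+c-b-d, f-h+b+d+a+c, -e-c+d, -f-d-c, ?_, ?_⟩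
  · rw [u₄_eq, Omat_mul]; congr 1 <;> ring
  · simp only [nm, pm, pn, ps, pt]; ring

theorem step8 (a b c d e f g h : ℤ) :
    ∃ a' b' c' d' e' f' g' h' : ℤ, Omat a b c d e f g h = u₅⁻¹ * Omat a' b' c' d' e' f' g' h' ∧
      nm a' b' c' d' e' f' g' h' = nm a b c d e f g h + ((7) * pm a b c d e f g h + (6) * pn a b c d e f g h + (8) * ps a b c d e f g h + (-6) * pt a b c d e f g h) := by
  refine ⟨a-b-f-h-e-2*g, b+a+e+g-f-2*h, c-d+h+g+e, d+c-g+h+f, e-f+a+c-b-2*d, f+e+b+d+a+2*c, g-h-c+d+b, h+g-d-c-a, ?_, ?_⟩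
  · rw [u₅_inv, Omat_mul]; congr 1 <;> ring
  · simp only [nm, pm, pn, ps, pt]; ring

theorem step9 (a b c d e f g h : ℤ) :
    ∃ a' b' c' d' e' f' g' h' : ℤ, Omat a b c d e f g h = u₅ * Omat a' b' c' d' e' f' g' h' ∧
      nm a' b' c' d' e' f' g' h' = nm a b c d e f g h + ((7) * pm a b c d e f g h + (6) * pn a b c d e f g h + (-8) * ps a b c d e f g h + (6) * pt a b c d e f g h) := by
  refine ⟨a-b+f+h+e+2*g, b+a-e-g+f+2*h, c-d-h-g-e, d+c+g-h-f, e-f-a-c+b+2*d, f+e-b-d-a-2*c, g-h+c-d-b, h+g+d+c+a, ?_, ?_⟩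
  · rw [u₅_eq, Omat_mul]; congr 1 <;> ring
  · simp only [nm, pm, pn, ps, pt]; ring

theorem step10 (a b c d e f g h : ℤ) :
    ∃ a' b' c' d' e' f' g' h' : ℤ, Omat a b c d e f g h = u₆⁻¹ * Omat a' b' c' d' e' f' g' h' ∧
      nm a' b' c' d' e' f' g' h' = nm a b c d e f g h + ((7) * pm a b c d e f g h + (1) * pn a b c d e f g h + (8) * ps a b c d e f g h + (14) * pt a b c d e f g h) := by
  refine ⟨a-b-f-h+g, b+a+e+g+h, c-d+h-e, d+c-g-f, e-f+a+c+d, f+e+b+d-c, g-h-c-b, h+g-d+a, ?_, ?_⟩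
  · rw [u₆_inv, Omat_mul]; congr 1 <;> ring
  · simp only [nm, pm, pn, ps, pt]; ring

theorem step11 (a b c d e f g h : ℤ) :
    ∃ a' b' c' d' e' f' g' h' : ℤ, Omat a b c d e f g h = u₆ * Omat a' b' c' d' e' f' g' h' ∧
      nm a' b' c' d' e' f' g' h' = nm a b c d e f g h + ((7) * pm a b c d e f g h + (1) * pn a b c d e f g h + (-8) * ps a b c d e f g h + (-14) * pt a b c d e f g h) := by
  refine ⟨a-b+f+h-g, b+a-e-g-h, c-d-h+e, d+c+g+f, e-f-a-c-d, f+e-b-d+c, g-h+c+b, h+g+d-a, ?_, ?_⟩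
  · rw [u₆_eq, Omat_mul]; congr 1 <;> ring
  · simp only [nm, pm, pn, ps, pt]; ring

theorem step12 (a b c d e f g h : ℤ) :
    ∃ a' b' c' d' e' f' g' h' : ℤ, Omat a b c d e f g h = u₇⁻¹ * Omat a' b' c' d' e' f' g' h' ∧
      nm a' b' c' d' e' f' g' h' = nm a b c d e f g h + ((7) * pm a b c d e f g h + (6) * pn a b c d e f g h + (-8) * ps a b c d e f g h + (-14) * pt a b c d e f g h) := by
  refine ⟨a+b-f-2*h-e-g, b-a+e+2*g-f-h, c+d+h+g+f, d-c-g+h-e, e+f+a+2*c-b-d, f-e+b+2*d+a+c, g+h-c+d-a, h-g-d-c-b, ?_, ?_⟩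
  · rw [u₇_inv, Omat_mul]; congr 1 <;> ring
  · simp only [nm, pm, pn, ps, pt]; ring

theorem step13 (a b c d e f g h : ℤ) :
    ∃ a' b' c' d' e' f' g' h' : ℤ, Omat a b c d e f g h = u₇ * Omat a' b' c' d' e' f' g' h' ∧
      nm a' b' c' d' e' f' g' h' = nm a b c d e f g h + ((7) * pm a b c d e f g h + (6) * pn a b c d e f g h + (8) * ps a b c d e f g h + (14) * pt a b c d e f g h) := by
  refine ⟨a+b+f+2*h+e+g, b-a-e-2*g+f+h, c+d-h-g-f, d-c+g-h+e, e+f-a-2*c+b+d, f-e-b-2*d-a-c, g+h+c-d+a, h-g+d+c+b, ?_, ?_⟩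
  · rw [u₇_eq, Omat_mul]; congr 1 <;> ring
  · simp only [nm, pm, pn, ps, pt]; ring

theorem step14 (a b c d e f g h : ℤ) :
    ∃ a' b' c' d' e' f' g' h' : ℤ, Omat a b c d e f g h = u₈⁻¹ * Omat a' b' c' d' e' f' g' h' ∧
      nm a' b' c' d' e' f' g' h' = nm a b c d e f g h + ((7) * pm a b c d e f g h + (1) * pn a b c d e f g h + (-8) * ps a b c d e f g h + (6) * pt a b c d e f g h) := by
  refine ⟨a+b-e-g+h, b-a-f-h-g, c+d+g-f, d-c+h+e, e+f-b-d-c, f-e+a+c-d, g+h+d+a, h-g-c+b, ?_, ?_⟩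
  · rw [u₈_inv, Omat_mul]; congr 1 <;> ring
  · simp only [nm, pm, pn, ps, pt]; ring

theorem step15 (a b c d e f g h : ℤ) :
    ∃ a' b' c' d' e' f' g' h' : ℤ, Omat a b c d e f g h = u₈ * Omat a' b' c' d' e' f' g' h' ∧
      nm a' b' c' d' e' f' g' h' = nm a b c d e f g h + ((7) * pm a b c d e f g h + (1) * pn a b c d e f g h + (8) * ps a b c d e f g h + (-6) * pt a b c d e f g h) := by
  refine ⟨a+b+e+g-h, b-a+f+h+g, c+d-g+f, d-c-h-e, e+f+b+d+c, f-e-a-c+d, g+h-d-a, h-g+c-b, ?_, ?_⟩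
  · rw [u₈_eq, Omat_mul]; congr 1 <;> ring
  · simp only [nm, pm, pn, ps, pt]; ring

theorem neg_one_mem : Omat (-1) 0 0 0 0 0 0 0 ∈ Submonoid.closure gens := by
  have h3 : u₃ ∈ Submonoid.closure gens := mem_gens (by simp [gens])
  have : Omat (-1) 0 0 0 0 0 0 0 = u₃ * u₃ * u₃ := by
    rw [u₃_eq, Omat_mul, Omat_mul]; congr 1
  rw [this]
  exact mul_mem (mul_mem h3 h3) h3

theorem main_aux (k : ℕ) : ∀ a b c d e f g h : ℤ, nm a b c d e f g h < k → (Omat a b c d e f g h).det = 1 →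
    Omat a b c d e f g h ∈ Submonoid.closure gens := by
  induction k with
  | zero =>
    intro a b c d e f g h hk _
    exfalso
    have hA := (pair_small a c).1
    have hB := (pair_small b d).1
    have hE := (pair_small e g).1
    have hF := (pair_small f h).1
    unfold nm at hk
    push_cast at hk
    omega
  | succ k ih =>
  intro a b c d e f g h hk hdet
  push_cast at hk
  have red : ∀ G ∈ gens, G.det = 1 → ∀ a' b' c' d' e' f' g' h' : ℤ,
      Omat a b c d e f g h = G * Omat a' b' c' d' e' f' g' h' →
      nm a' b' c' d' e' f' g' h' < nm a b c d e f g h → Omat a b c d e f g h ∈ Submonoid.closure gens := by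
    intro G hG hGd a' b' c' d' e' f' g' h' hM hlt
    rw [hM]
    refine mul_mem (mem_gens hG) (ih _ _ _ _ _ _ _ _ (by omega) ?_)
    rw [hM, Matrix.det_mul, hGd, one_mul] at hdet
    exact hdet
  by_cases h0 : 0 ≤ (1) * pm a b c d e f g h + (3) * pn a b c d e f g h + (0) * ps a b c d e f g h + (0) * pt a b c d e f g h
  swap
  · obtain ⟨a', b', c', d', e', f', g', h', hM, hnm⟩ := step0 a b c d e f g h
    exact red _ (by simp [gens]) (by simp [u₁_inv, det_Omat, gold_one]) _ _ _ _ _ _ _ _ hM (by omega)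
  by_cases h1 : 0 ≤ (1) * pm a b c d e f g h + (-2) * pn a b c d e f g h + (0) * ps a b c d e f g h + (0) * pt a b c d e f g h
  swap
  · obtain ⟨a', b', c', d', e', f', g', h', hM, hnm⟩ := step1 a b c d e f g h
    exact red _ (by simp [gens]) (by simp [u₁_eq, det_Omat, gold_one]) _ _ _ _ _ _ _ _ hM (by omega)
  by_cases h2 : 0 ≤ (4) * pm a b c d e f g h + (2) * pn a b c d e f g h + (8) * ps a b c d e f g h + (4) * pt a b c d e f g h
  swap
  · obtain ⟨a', b', c', d', e', f', g', h', hM, hnm⟩ := step2 a b c d e f g h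
    exact red _ (by simp [gens]) (by simp [u₂_inv, det_Omat, gold_one]) _ _ _ _ _ _ _ _ hM (by omega)
  by_cases h3 : 0 ≤ (4) * pm a b c d e f g h + (2) * pn a b c d e f g h + (-8) * ps a b c d e f g h + (-4) * pt a b c d e f g h
  swap
  · obtain ⟨a', b', c', d', e', f', g', h', hM, hnm⟩ := step3 a b c d e f g h
    exact red _ (by simp [gens]) (by simp [u₂_eq, det_Omat, gold_one]) _ _ _ _ _ _ _ _ hM (by omega)
  by_cases h4 : 0 ≤ (5) * pm a b c d e f g h + (5) * pn a b c d e f g h + (0) * ps a b c d e f g h + (10) * pt a b c d e f g h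
  swap
  · obtain ⟨a', b', c', d', e', f', g', h', hM, hnm⟩ := step4 a b c d e f g h
    exact red _ (by simp [gens]) (by simp [u₃_inv, det_Omat, gold_one]) _ _ _ _ _ _ _ _ hM (by omega)
  by_cases h5 : 0 ≤ (5) * pm a b c d e f g h + (0) * pn a b c d e f g h + (0) * ps a b c d e f g h + (10) * pt a b c d e f g h
  swap
  · obtain ⟨a', b', c', d', e', f', g', h', hM, hnm⟩ := step5 a b c d e f g h
    exact red _ (by simp [gens]) (by simp [u₃_eq, det_Omat, gold_one]) _ _ _ _ _ _ _ _ hM (by omega)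
  by_cases h6 : 0 ≤ (5) * pm a b c d e f g h + (5) * pn a b c d e f g h + (0) * ps a b c d e f g h + (-10) * pt a b c d e f g h
  swap
  · obtain ⟨a', b', c', d', e', f', g', h', hM, hnm⟩ := step6 a b c d e f g h
    exact red _ (by simp [gens]) (by simp [u₄_inv, det_Omat, gold_one]) _ _ _ _ _ _ _ _ hM (by omega)
  by_cases h7 : 0 ≤ (5) * pm a b c d e f g h + (0) * pn a b c d e f g h + (0) * ps a b c d e f g h + (-10) * pt a b c d e f g h
  swap
  · obtain ⟨a', b', c', d', e', f', g', h', hM, hnm⟩ := step7 a b c d e f g h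
    exact red _ (by simp [gens]) (by simp [u₄_eq, det_Omat, gold_one]) _ _ _ _ _ _ _ _ hM (by omega)
  by_cases h8 : 0 ≤ (7) * pm a b c d e f g h + (6) * pn a b c d e f g h + (8) * ps a b c d e f g h + (-6) * pt a b c d e f g h
  swap
  · obtain ⟨a', b', c', d', e', f', g', h', hM, hnm⟩ := step8 a b c d e f g h
    exact red _ (by simp [gens]) (by simp [u₅_inv, det_Omat, gold_one]) _ _ _ _ _ _ _ _ hM (by omega)
  by_cases h9 : 0 ≤ (7) * pm a b c d e f g h + (6) * pn a b c d e f g h + (-8) * ps a b c d e f g h + (6) * pt a b c d e f g h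
  swap
  · obtain ⟨a', b', c', d', e', f', g', h', hM, hnm⟩ := step9 a b c d e f g h
    exact red _ (by simp [gens]) (by simp [u₅_eq, det_Omat, gold_one]) _ _ _ _ _ _ _ _ hM (by omega)
  by_cases h10 : 0 ≤ (7) * pm a b c d e f g h + (1) * pn a b c d e f g h + (8) * ps a b c d e f g h + (14) * pt a b c d e f g h
  swap
  · obtain ⟨a', b', c', d', e', f', g', h', hM, hnm⟩ := step10 a b c d e f g h
    exact red _ (by simp [gens]) (by simp [u₆_inv, det_Omat, gold_one]) _ _ _ _ _ _ _ _ hM (by omega)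
  by_cases h11 : 0 ≤ (7) * pm a b c d e f g h + (1) * pn a b c d e f g h + (-8) * ps a b c d e f g h + (-14) * pt a b c d e f g h
  swap
  · obtain ⟨a', b', c', d', e', f', g', h', hM, hnm⟩ := step11 a b c d e f g h
    exact red _ (by simp [gens]) (by simp [u₆_eq, det_Omat, gold_one]) _ _ _ _ _ _ _ _ hM (by omega)
  by_cases h12 : 0 ≤ (7) * pm a b c d e f g h + (6) * pn a b c d e f g h + (-8) * ps a b c d e f g h + (-14) * pt a b c d e f g h
  swap
  · obtain ⟨a', b', c', d', e', f', g', h', hM, hnm⟩ := step12 a b c d e f g h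
    exact red _ (by simp [gens]) (by simp [u₇_inv, det_Omat, gold_one]) _ _ _ _ _ _ _ _ hM (by omega)
  by_cases h13 : 0 ≤ (7) * pm a b c d e f g h + (6) * pn a b c d e f g h + (8) * ps a b c d e f g h + (14) * pt a b c d e f g h
  swap
  · obtain ⟨a', b', c', d', e', f', g', h', hM, hnm⟩ := step13 a b c d e f g h
    exact red _ (by simp [gens]) (by simp [u₇_eq, det_Omat, gold_one]) _ _ _ _ _ _ _ _ hM (by omega)
  by_cases h14 : 0 ≤ (7) * pm a b c d e f g h + (1) * pn a b c d e f g h + (-8) * ps a b c d e f g h + (6) * pt a b c d e f g h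
  swap
  · obtain ⟨a', b', c', d', e', f', g', h', hM, hnm⟩ := step14 a b c d e f g h
    exact red _ (by simp [gens]) (by simp [u₈_inv, det_Omat, gold_one]) _ _ _ _ _ _ _ _ hM (by omega)
  by_cases h15 : 0 ≤ (7) * pm a b c d e f g h + (1) * pn a b c d e f g h + (8) * ps a b c d e f g h + (-6) * pt a b c d e f g h
  swap
  · obtain ⟨a', b', c', d', e', f', g', h', hM, hnm⟩ := step15 a b c d e f g h
    exact red _ (by simp [gens]) (by simp [u₈_eq, det_Omat, gold_one]) _ _ _ _ _ _ _ _ hM (by omega)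
  have hd := hdet
  rw [det_Omat, gold_eq_one] at hd
  have hform := form_eq a b c d e f g h
  rw [hd.1, hd.2] at hform
  have hpos : 0 ≤ nm a b c d e f g h := by
    have hA := (pair_small a c).1
    have hB := (pair_small b d).1
    have hE := (pair_small e g).1
    have hF := (pair_small f h).1
    unfold nm
    omega
  have hne : nm a b c d e f g h ≠ 0 := by
    intro h0
    rw [nm_eq] at h0
    generalize pm a b c d e f g h = m at *
    generalize pn a b c d e f g h = n at *
    generalize ps a b c d e f g h = s at *
    generalize pt a b c d e f g h = t at *
    obtain rfl : n = -2 * m := by omega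
    nlinarith [sq_nonneg m, sq_nonneg (2 * s + t), sq_nonneg t]
  have hD := dirichlet (pm a b c d e f g h) (pn a b c d e f g h) (ps a b c d e f g h) (pt a b c d e f g h)
    (by rw [← nm_eq]; omega) (by linarith) h0 h1 h2 h3 h4 h5 h6 h7 h8 h9 h10 h11 h12 h13 h14 h15
  rw [← nm_eq] at hD
  obtain ⟨ha, rfl, rfl, rfl, rfl, rfl, rfl, rfl⟩ := small a b c d e f g h hD hd.1 hd.2
  rcases ha with rfl | rfl
  · rw [Omat_one]; exact one_mem _
  · exact neg_one_mem

theorem O1_mul (M N : Matrix (Fin 2) (Fin 2) ℂ) (hM : M ∈ O1) (hN : N ∈ O1) : M * N ∈ O1 := by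
  obtain ⟨⟨a, b, c, d, e, f, g, h, rfl⟩, h1⟩ := hM
  obtain ⟨⟨a', b', c', d', e', f', g', h', rfl⟩, h2⟩ := hN
  refine ⟨⟨_, _, _, _, _, _, _, _, Omat_mul _ _ _ _ _ _ _ _ _ _ _ _ _ _ _ _⟩, ?_⟩
  rw [Matrix.det_mul, h1, h2, one_mul]

theorem O1_of_eq (M : Matrix (Fin 2) (Fin 2) ℂ) (a b c d e f g h : ℤ)
    (hM : M = Omat a b c d e f g h)
    (h1 : a*a-b*b+a*c-b*d-c*c+d*d + (2*e*f+e*h+f*g-2*g*h) = 1)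
    (h2 : 2*a*b+a*d+b*c-2*c*d - (e*e-f*f+e*g-f*h-g*g+h*h) = 0) : M ∈ O1 := by
  refine ⟨⟨a, b, c, d, e, f, g, h, hM⟩, ?_⟩
  rw [hM, det_Omat, gold_eq_one]
  exact ⟨h1, h2⟩

theorem gens_sub (M : Matrix (Fin 2) (Fin 2) ℂ) (hM : M ∈ gens) : M ∈ O1 := by
  simp only [gens, Set.mem_insert_iff, Set.mem_singleton_iff] at hM
  rcases hM with rfl | rfl | rfl | rfl | rfl | rfl | rfl | rfl | rfl | rfl | rfl | rfl | rfl | rfl | rfl | rfl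
  · exact O1_of_eq _ _ _ _ _ _ _ _ _ u₁_eq (by norm_num) (by norm_num)
  · exact O1_of_eq _ _ _ _ _ _ _ _ _ u₂_eq (by norm_num) (by norm_num)
  · exact O1_of_eq _ _ _ _ _ _ _ _ _ u₃_eq (by norm_num) (by norm_num)
  · exact O1_of_eq _ _ _ _ _ _ _ _ _ u₄_eq (by norm_num) (by norm_num)
  · exact O1_of_eq _ _ _ _ _ _ _ _ _ u₅_eq (by norm_num) (by norm_num)
  · exact O1_of_eq _ _ _ _ _ _ _ _ _ u₆_eq (by norm_num) (by norm_num)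
  · exact O1_of_eq _ _ _ _ _ _ _ _ _ u₇_eq (by norm_num) (by norm_num)
  · exact O1_of_eq _ _ _ _ _ _ _ _ _ u₈_eq (by norm_num) (by norm_num)
  · exact O1_of_eq _ _ _ _ _ _ _ _ _ u₁_inv (by norm_num) (by norm_num)
  · exact O1_of_eq _ _ _ _ _ _ _ _ _ u₂_inv (by norm_num) (by norm_num)
  · exact O1_of_eq _ _ _ _ _ _ _ _ _ u₃_inv (by norm_num) (by norm_num)
  · exact O1_of_eq _ _ _ _ _ _ _ _ _ u₄_inv (by norm_num) (by norm_num)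
  · exact O1_of_eq _ _ _ _ _ _ _ _ _ u₅_inv (by norm_num) (by norm_num)
  · exact O1_of_eq _ _ _ _ _ _ _ _ _ u₆_inv (by norm_num) (by norm_num)
  · exact O1_of_eq _ _ _ _ _ _ _ _ _ u₇_inv (by norm_num) (by norm_num)
  · exact O1_of_eq _ _ _ _ _ _ _ _ _ u₈_inv (by norm_num) (by norm_num)

/-- The subgroup of `GL₂(ℂ)` generated by `u₁,…,u₈` equals `O¹`: a matrix lies in `O¹` iff
it is a finite product of the matrices `u₁,…,u₈` and their inverses. -/
theorem O1_eq_closure (M : Matrix (Fin 2) (Fin 2) ℂ) :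
    M ∈ O1 ↔ M ∈ Submonoid.closure
      ({u₁, u₂, u₃, u₄, u₅, u₆, u₇, u₈,
        u₁⁻¹, u₂⁻¹, u₃⁻¹, u₄⁻¹, u₅⁻¹, u₆⁻¹, u₇⁻¹, u₈⁻¹} :
        Set (Matrix (Fin 2) (Fin 2) ℂ)) := by
  change M ∈ O1 ↔ M ∈ Submonoid.closure gens
  constructor
  · rintro ⟨⟨a, b, c, d, e, f, g, h, rfl⟩, hdet⟩
    exact main_aux ((nm a b c d e f g h).toNat + 1) _ _ _ _ _ _ _ _ (by omega) hdet
  · intro hM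
    induction hM using Submonoid.closure_induction with
    | mem x hx => exact gens_sub x hx
    | one => exact O1_of_eq _ 1 0 0 0 0 0 0 0 Omat_one.symm (by norm_num) (by norm_num)
    | mul x y _ _ hx hy => exact O1_mul x y hx hy
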